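/- Every element x ∈ ᴵW is fully commutative: no reduced word for x contains a consecutive subword of the form (s, t, s) with (s t)^3 = 1, or of the form (s, t, s, t) with (s t)^4 = 1. -/

import Mathlib

open List

/-- The Coxeter matrix of type `Bₙ` with the 4-bond between `s₀` and `s₁`. -/
def BCox (n : ℕ) : CoxeterMatrix (Fin n) where
  M := Matrix.of fun i j : Fin n ↦
    if i = j then 1
      else if (i : ℕ) + (j : ℕ) = 1 then 4
      else if (j : ℕ) + 1 = (i : ℕ) ∨ (i : ℕ) + 1 = (j : ℕ) then 3 else 2
  isSymm := by
    unfold Matrix.IsSymm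
    ext i j
    simp only [Matrix.transpose_apply, Matrix.of_apply]
    rcases eq_or_ne i j with h | h
    · subst h; simp
    · rw [if_neg h, if_neg (Ne.symm h)]
      split_ifs <;> omega
  diagonal := by simp
  off_diagonal := by
    intro i j hij
    simp only [Matrix.of_apply, if_neg hij]
    split_ifs <;> simp

/-- The set `ᴵW` of minimal length representatives of the cosets `W_I∖W`,
where `I = {s₁, …, s_{n−1}}`. -/
def IWset {n : ℕ} {W : Type*} [Group W] (cs : CoxeterSystem (BCox n) W) : Set W :=
  {x | ∀ i : Fin n, (i : ℕ) ≠ 0 → cs.length x < cs.length (cs.simple i * x)}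


namespace BProof

variable {W : Type*} [Group W]

/-- `c p = s 0 * s 1 * ... * s p`. -/
def c (s : ℕ → W) : ℕ → W
  | 0 => s 0
  | p + 1 => c s p * s (p + 1)

/-- The canonical coset representative attached to a sign vector. -/
def M (s : ℕ → W) (v : ℕ → Bool) : ℕ → W
  | 0 => 1
  | q + 1 => (if v q then c s q else 1) * M s v q

/-- Right action of the simple reflections on sign vectors. -/
def act (v : ℕ → Bool) (j : ℕ) : ℕ → Bool :=
  if j = 0 then fun k => if k = 0 then !(v 0) else v k
  else fun k => if k = j then v (j - 1) else if k = j - 1 then v j else v k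

structure Rels (n : ℕ) (s : ℕ → W) : Prop where
  sq : ∀ i, s i * s i = 1
  comm : ∀ i j, i + 2 ≤ j → s i * s j = s j * s i
  braid : ∀ i, 1 ≤ i → i + 1 < n → s i * s (i + 1) * s i = s (i + 1) * s i * s (i + 1)
  four : 2 ≤ n → s 0 * s 1 * s 0 * s 1 = s 1 * s 0 * s 1 * s 0

variable {n : ℕ} {s : ℕ → W}

lemma c_comm (R : Rels n s) (p k : ℕ) (h : p + 2 ≤ k) : c s p * s k = s k * c s p := by
  induction p with
  | zero => exact R.comm 0 k h
  | succ p ih =>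
    simp only [c]
    rw [mul_assoc, R.comm (p + 1) k h, ← mul_assoc, ih (by omega), mul_assoc]

lemma c_shift (R : Rels n s) (p j : ℕ) (hj : 1 ≤ j) (hp : j < p) (hn : p < n) :
    c s p * s j = s (j + 1) * c s p := by
  induction p with
  | zero => omega
  | succ p ih =>
    rcases Nat.lt_or_ge j p with h | h
    · simp only [c]
      rw [mul_assoc, ← R.comm j (p + 1) (by omega), ← mul_assoc, ih h (by omega), mul_assoc]
    · obtain rfl : p = j := by omega
      obtain ⟨m, rfl⟩ : ∃ m, p = m + 1 := ⟨p - 1, by omega⟩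
      have hb := R.braid (m + 1) (by omega) hn
      have hc := c_comm R m (m + 1 + 1) (by omega)
      simp only [c]
      calc c s m * s (m + 1) * s (m + 1 + 1) * s (m + 1)
          = c s m * (s (m + 1) * s (m + 1 + 1) * s (m + 1)) := by group
        _ = c s m * s (m + 1 + 1) * s (m + 1) * s (m + 1 + 1) := by rw [hb]; group
        _ = _ := by rw [hc]; group

lemma c_cc (R : Rels n s) (j : ℕ) (hn : j + 1 < n) :
    c s (j + 1) * c s (j + 1) = s 1 * c s (j + 1) * c s j := by
  induction j with
  | zero =>
    have := R.four (by omega)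
    simp only [c]
    simpa [mul_assoc] using this
  | succ j ih =>
    have ih := ih (by omega)
    have hb := R.braid (j + 1) (by omega) hn
    have hc := c_comm R j (j + 1 + 1) (by omega)
    have e1 : c s (j + 1) = c s j * s (j + 1) := rfl
    have e2 : c s (j + 1 + 1) = c s (j + 1) * s (j + 1 + 1) := rfl
    calc c s (j + 1 + 1) * c s (j + 1 + 1)
        = c s (j + 1) * (s (j + 1 + 1) * c s j) * s (j + 1) * s (j + 1 + 1) := by
          rw [e2]; nth_rewrite 2 [e1]; group
      _ = c s (j + 1) * c s j * (s (j + 1 + 1) * s (j + 1) * s (j + 1 + 1)) := by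
          rw [← hc]; group
      _ = c s (j + 1) * (c s j * s (j + 1)) * s (j + 1 + 1) * s (j + 1) := by
          rw [← hb]; group
      _ = s 1 * c s (j + 1) * (c s j * s (j + 1 + 1)) * s (j + 1) := by
          rw [← e1, ih]; group
      _ = s 1 * (c s (j + 1) * s (j + 1 + 1)) * (c s j * s (j + 1)) := by
          rw [hc]; group
      _ = _ := by rw [← e2, ← e1]

lemma M_comm (R : Rels n s) (v : ℕ → Bool) (q k : ℕ) (h : q + 1 ≤ k) :
    M s v q * s k = s k * M s v q := by
  induction q with
  | zero => simp [M]
  | succ q ih =>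
    simp only [M]
    rw [mul_assoc, ih (by omega), ← mul_assoc]
    split_ifs
    · rw [c_comm R q k (by omega), mul_assoc]
    · simp

lemma M_congr (v v' : ℕ → Bool) (q : ℕ) (h : ∀ k < q, v k = v' k) : M s v q = M s v' q := by
  induction q with
  | zero => rfl
  | succ q ih =>
    simp only [M]
    rw [ih (fun k hk => h k (by omega)), h q (by omega)]

lemma M_fix (R : Rels n s) (v : ℕ → Bool) (q j : ℕ) (hj : j + 1 < q) (hq : q ≤ n)
    (hv : v j = v (j + 1)) :
    ∃ i, 1 ≤ i ∧ i < q ∧ M s v q * s (j + 1) = s i * M s v q := by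
  induction q with
  | zero => omega
  | succ q ih =>
    rcases Nat.lt_or_ge (j + 1) q with h | h
    · obtain ⟨i, h1, h2, h3⟩ := ih h (by omega)
      simp only [M]
      by_cases hvq : v q
      · refine ⟨i + 1, by omega, by omega, ?_⟩
        rw [if_pos hvq, mul_assoc, h3, ← mul_assoc, c_shift R q i h1 h2 (by omega), mul_assoc]
      · refine ⟨i, by omega, by omega, ?_⟩
        rw [if_neg hvq, one_mul, h3]
    · obtain rfl : q = j + 1 := by omega
      have hM := M_comm R v j (j + 1) le_rfl
      simp only [M]
      rw [← hv]
      by_cases hvj : v j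
      · refine ⟨1, le_rfl, by omega, ?_⟩
        have hcc := c_cc R j (by omega)
        simp only [if_pos hvj]
        calc c s (j + 1) * (c s j * M s v j) * s (j + 1)
            = c s (j + 1) * c s j * (M s v j * s (j + 1)) := by group
          _ = c s (j + 1) * (c s j * s (j + 1)) * M s v j := by rw [hM]; group
          _ = c s (j + 1) * c s (j + 1) * M s v j := rfl
          _ = _ := by rw [hcc]; group
      · refine ⟨j + 1, by omega, by omega, ?_⟩
        simpa [hvj] using hM

lemma M_move (R : Rels n s) (v : ℕ → Bool) (q j : ℕ) (hj : j + 1 < q)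
    (hv : v j ≠ v (j + 1)) :
    M s v q * s (j + 1) = M s (act v (j + 1)) q := by
  induction q with
  | zero => omega
  | succ q ih =>
    rcases Nat.lt_or_ge (j + 1) q with h | h
    · simp only [M]
      rw [mul_assoc, ih h]
      have : act v (j + 1) q = v q := by
        simp only [act]
        rw [if_neg (by omega), if_neg (by omega), if_neg (by omega)]
      rw [this]
    · obtain rfl : q = j + 1 := by omega
      have hM := M_comm R v j (j + 1) le_rfl
      have h1 : act v (j + 1) (j + 1) = v j := by simp [act]
      have h2 : act v (j + 1) j = v (j + 1) := by simp [act]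
      have h3 : M s (act v (j + 1)) j = M s v j := by
        apply M_congr
        intro k hk
        simp only [act]
        rw [if_neg (by omega), if_neg (by omega), if_neg (by omega)]
      simp only [M]
      rw [h1, h2, h3]
      cases ha : v j <;> cases hb : v (j + 1) <;> simp [ha, hb] at hv ⊢
      · rw [mul_assoc, hM, c, ← mul_assoc, mul_assoc (c s j), R.sq, mul_one]
      · rw [mul_assoc, hM, c, ← mul_assoc]

lemma M_zero (R : Rels n s) (v : ℕ → Bool) (q : ℕ) :
    M s v (q + 1) * s 0 = M s (act v 0) (q + 1) := by
  induction q with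
  | zero =>
    cases h : v 0 <;> simp [M, act, h, c, R.sq]
  | succ q ih =>
    rw [M, mul_assoc, ih]
    conv_rhs => rw [M]
    have : act v 0 (q + 1) = v (q + 1) := by simp [act]
    rw [this]

lemma M_cases (i j : Fin n) : i = j ∨ ((i : ℕ) + j = 1 ∧ BCox n i j = 4) ∨
    ((i : ℕ) ≠ 0 ∧ (j : ℕ) ≠ 0 ∧ ((j : ℕ) + 1 = i ∨ (i : ℕ) + 1 = j) ∧ BCox n i j = 3) ∨
    (BCox n i j = 2 ∧ (i : ℕ) + j ≠ 1 ∧ (j : ℕ) + 1 ≠ i ∧ (i : ℕ) + 1 ≠ j) := by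
  have e : BCox n i j = if i = j then 1
      else if (i : ℕ) + (j : ℕ) = 1 then 4
      else if (j : ℕ) + 1 = (i : ℕ) ∨ (i : ℕ) + 1 = (j : ℕ) then 3 else 2 := rfl
  rw [e]
  split_ifs with h1 h2 h3
  · exact Or.inl h1
  · exact Or.inr (Or.inl ⟨h2, rfl⟩)
  · refine Or.inr (Or.inr (Or.inl ⟨?_, ?_, h3, rfl⟩)) <;> omega
  · refine Or.inr (Or.inr (Or.inr ⟨rfl, h2, ?_, ?_⟩)) <;> omega

/-- Simple reflections indexed by naturals. -/
noncomputable def ss (cs : CoxeterSystem (BCox n) W) (i : ℕ) : W :=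
  if h : i < n then cs.simple ⟨i, h⟩ else 1

lemma ss_val (cs : CoxeterSystem (BCox n) W) (i : Fin n) : ss cs i = cs.simple i := by
  simp [ss]

lemma rels (cs : CoxeterSystem (BCox n) W) : Rels n (ss cs) where
  sq i := by
    unfold ss
    split_ifs <;> simp
  comm i j h := by
    by_cases hj : j < n
    · have hi : i < n := by omega
      have e := cs.simple_mul_simple_pow ⟨i, hi⟩ ⟨j, hj⟩
      have hm : (BCox n) ⟨i, hi⟩ ⟨j, hj⟩ = 2 := by
        have hc := M_cases (n := n) ⟨i, hi⟩ ⟨j, hj⟩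
        simp only [Fin.mk.injEq] at hc
        omega
      rw [hm] at e
      simp only [ss, hi, hj, dif_pos]
      rw [pow_two] at e
      have := eq_inv_of_mul_eq_one_left e
      simpa using this
    · simp [ss, hj]
  braid i h1 hn := by
    have hi : i < n := by omega
    have e := cs.simple_mul_simple_pow ⟨i, hi⟩ ⟨i + 1, hn⟩
    have hm : (BCox n) ⟨i, hi⟩ ⟨i + 1, hn⟩ = 3 := by
      have hc := M_cases (n := n) ⟨i, hi⟩ ⟨i + 1, hn⟩
      simp only [Fin.mk.injEq] at hc
      omega
    rw [hm] at e
    simp only [ss, hi, hn, dif_pos]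
    set a := cs.simple ⟨i, hi⟩
    set b := cs.simple ⟨i + 1, hn⟩
    have e' : (a * b * a) * (b * a * b) = 1 := by rw [← e]; simp [pow_succ, mul_assoc]
    have := eq_inv_of_mul_eq_one_left e'
    rw [this]
    simp [a, b, mul_assoc]
  four hn := by
    have hi : 0 < n := by omega
    have hj : 1 < n := by omega
    have e := cs.simple_mul_simple_pow ⟨0, hi⟩ ⟨1, hj⟩
    have hm : (BCox n) ⟨0, hi⟩ ⟨1, hj⟩ = 4 := by
      have hc := M_cases (n := n) ⟨0, hi⟩ ⟨1, hj⟩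
      simp only [Fin.mk.injEq] at hc
      omega
    rw [hm] at e
    simp only [ss, hi, hj, dif_pos]
    set a := cs.simple ⟨0, hi⟩
    set b := cs.simple ⟨1, hj⟩
    have e' : (a * b * a * b) * (a * b * a * b) = 1 := by rw [← e]; simp [pow_succ, mul_assoc]
    have := eq_inv_of_mul_eq_one_left e'
    rw [this]
    simp [a, b, mul_assoc]

/-- The sign vector reached by a word. -/
def V (u : List (Fin n)) : ℕ → Bool := u.foldl (fun v j => act v j) (fun _ => false)

lemma V_snoc (u : List (Fin n)) (j : Fin n) : V (u ++ [j]) = act (V u) j := by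
  simp [V]

lemma M_false (q : ℕ) : M s (fun _ => false) q = 1 := by
  induction q with
  | zero => rfl
  | succ q ih => simp [M, ih]

lemma step (cs : CoxeterSystem (BCox n) W) (w : List (Fin n)) (hred : cs.IsReduced w)
    (hx : cs.wordProd w ∈ IWset cs) (u : List (Fin n)) (j : Fin n) (v : List (Fin n))
    (hw : w = u ++ j :: v) (hu : cs.wordProd u = M (ss cs) (V u) n) (hj : (j : ℕ) ≠ 0) :
    V u (j - 1) ≠ V u j := by
  intro hv
  obtain ⟨k, hk⟩ : ∃ k, (j : ℕ) = k + 1 := ⟨j - 1, by omega⟩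
  have hjn := j.2
  obtain ⟨i, h1, h2, h3⟩ := M_fix (rels cs) (V u) n k (by omega) le_rfl (by
    rw [hk] at hv; simpa using hv)
  rw [← hk, ss_val, ← hu, show ss cs i = cs.simple ⟨i, h2⟩ by simp [ss, h2]] at h3
  have hlt := hx ⟨i, h2⟩ (by simp; omega)
  have : cs.simple ⟨i, h2⟩ * cs.wordProd w = cs.wordProd (u ++ v) := by
    rw [hw, cs.wordProd_append, cs.wordProd_cons, cs.wordProd_append, ← mul_assoc, ← mul_assoc,
      mul_assoc _ (cs.wordProd u), h3]
    simp [← mul_assoc]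
  rw [this, hred] at hlt
  have := cs.length_wordProd_le (u ++ v)
  simp [hw] at this hlt
  omega

lemma pref (cs : CoxeterSystem (BCox n) W) (w : List (Fin n)) (hred : cs.IsReduced w)
    (hx : cs.wordProd w ∈ IWset cs) (u : List (Fin n)) : ∀ v, w = u ++ v →
    cs.wordProd u = M (ss cs) (V u) n := by
  induction u using List.reverseRecOn with
  | nil => intro v _; simp [V, M_false]
  | append_singleton u j ih =>
    intro v hw
    have hw' : w = u ++ j :: v := by simpa using hw
    have hu := ih _ hw'
    have hst := step cs w hred hx u j v hw' hu
    rw [cs.wordProd_append, cs.wordProd_singleton, V_snoc, hu, ← ss_val]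
    have hjn := j.2
    rcases Nat.eq_zero_or_pos (j : ℕ) with h0 | h0
    · rw [h0]
      obtain ⟨m, rfl⟩ : ∃ m, n = m + 1 := ⟨n - 1, by omega⟩
      exact M_zero (rels cs) _ _
    · obtain ⟨k, hk⟩ : ∃ k, (j : ℕ) = k + 1 := ⟨j - 1, by omega⟩
      have := hst (by omega)
      rw [hk] at this ⊢
      exact M_move (rels cs) _ _ _ (by omega) (by simpa using this)

lemma moves (cs : CoxeterSystem (BCox n) W) (w : List (Fin n)) (hred : cs.IsReduced w)
    (hx : cs.wordProd w ∈ IWset cs) (u : List (Fin n)) (j : Fin n) (v : List (Fin n))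
    (hw : w = u ++ j :: v) (hj : (j : ℕ) ≠ 0) : V u (j - 1) ≠ V u j :=
  step cs w hred hx u j v hw (pref cs w hred hx u _ hw) hj

lemma ne_of_red (cs : CoxeterSystem (BCox n) W) (w u v : List (Fin n)) (hred : cs.IsReduced w)
    (i j : Fin n) (hw : w = u ++ i :: j :: v) : cs.simple i * cs.simple j ≠ 1 := by
  intro h
  have e : cs.wordProd w = cs.wordProd (u ++ v) := by
    rw [hw, cs.wordProd_append, cs.wordProd_cons, cs.wordProd_cons, ← mul_assoc (cs.simple i), h,
      one_mul, cs.wordProd_append]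
  have h1 := cs.length_wordProd_le (u ++ v)
  rw [← e, hred] at h1
  simp [hw] at h1

/-- A reduced word has no factor `s t s t` with `s`, `t` commuting, nor `s t s`. -/
lemma ne_of_red2 (cs : CoxeterSystem (BCox n) W) (w u v : List (Fin n)) (hred : cs.IsReduced w)
    (i j : Fin n) (hw : w = u ++ i :: j :: i :: v) : (cs.simple i * cs.simple j) ^ 2 ≠ 1 := by
  intro h
  have e : cs.wordProd w = cs.wordProd (u ++ j :: v) := by
    have : cs.simple i * cs.simple j * cs.simple i = cs.simple j := by
      have h' : (cs.simple i * cs.simple j * cs.simple i) * cs.simple j = 1 := by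
        rw [← h]; simp [pow_succ, mul_assoc]
      simpa using eq_inv_of_mul_eq_one_left h'
    rw [hw, cs.wordProd_append, cs.wordProd_cons, cs.wordProd_cons, cs.wordProd_cons,
      cs.wordProd_append, cs.wordProd_cons, ← mul_assoc (cs.simple i), ← mul_assoc (cs.simple i * _), this]
  have h1 := cs.length_wordProd_le (u ++ j :: v)
  rw [← e, hred] at h1
  simp [hw] at h1

end BProof

/-- Every element `x ∈ ᴵW` is fully commutative: no reduced word for `x`
contains a consecutive subword of the form `(s, t, s)` with `(st)³ = 1`, or of the form
`(s, t, s, t)` with `(st)⁴ = 1`. -/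
theorem stmt_11 (n : ℕ) (hn : 2 ≤ n) {W : Type*} [Group W] (cs : CoxeterSystem (BCox n) W)
    (x : W) (hx : x ∈ IWset cs)
    (w : List (Fin n)) (hred : cs.IsReduced w) (hprod : cs.wordProd w = x) :
    ∀ s t : Fin n,
      ¬([s, t, s] <:+: w ∧ (cs.simple s * cs.simple t) ^ 3 = 1) ∧
      ¬([s, t, s, t] <:+: w ∧ (cs.simple s * cs.simple t) ^ 4 = 1) := by
  subst hprod
  intro s t
  have hpow := cs.simple_mul_simple_pow s t
  constructor
  · rintro ⟨⟨u, v, hw⟩, h3⟩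
    have hw0 : w = u ++ s :: t :: s :: v := by simp [← hw]
    have hne := BProof.ne_of_red cs w u _ hred s t hw0
    have hne2 := BProof.ne_of_red2 cs w u _ hred s t hw0
    rcases BProof.M_cases s t with h | ⟨_, h⟩ | ⟨hs, ht, h, _⟩ | ⟨h, _⟩
    · subst h; simp at hne
    · rw [h, pow_succ, h3, one_mul] at hpow
      exact hne hpow
    · have m1 := BProof.moves cs w hred hx u s _ hw0 hs
      have m2 := BProof.moves cs w hred hx (u ++ [s]) t (s :: v) (by simp [hw0]) ht
      have m3 := BProof.moves cs w hred hx (u ++ [s] ++ [t]) s v (by simp [hw0]) hs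
      simp only [BProof.V_snoc] at m2 m3
      generalize BProof.V u = f at m1 m2 m3
      obtain ⟨a, ha⟩ : ∃ a, (s : ℕ) = a + 1 := ⟨s - 1, by omega⟩
      obtain ⟨b, hb⟩ : ∃ b, (t : ℕ) = b + 1 := ⟨t - 1, by omega⟩
      rw [ha] at m1 m2 m3
      rw [hb] at m2 m3
      rcases h with h | h
      · obtain rfl : a = b + 1 := by omega
        have n1 : b + 1 + 1 ≠ b := by omega
        have n2 : b ≠ b + 1 + 1 := by omega
        simp [BProof.act, n1, n2] at m1 m2 m3
        revert m1 m2 m3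
        cases f b <;> cases f (b + 1) <;> cases f (b + 1 + 1) <;> simp
      · obtain rfl : b = a + 1 := by omega
        have n1 : a + 1 + 1 ≠ a := by omega
        have n2 : a ≠ a + 1 + 1 := by omega
        simp [BProof.act, n1, n2] at m1 m2 m3
        revert m1 m2 m3
        cases f a <;> cases f (a + 1) <;> cases f (a + 1 + 1) <;> simp
    · rw [h] at hpow; exact hne2 hpow
  · rintro ⟨⟨u, v, hw⟩, h4⟩
    have hw0 : w = u ++ s :: t :: s :: t :: v := by simp [← hw]
    have hne := BProof.ne_of_red cs w u _ hred s t hw0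
    have hne2 := BProof.ne_of_red2 cs w u _ hred s t hw0
    rcases BProof.M_cases s t with h | ⟨h, _⟩ | ⟨hs, ht, _, h⟩ | ⟨h, _⟩
    · subst h; simp at hne
    · have m1 := BProof.moves cs w hred hx u s _ hw0
      have m2 := BProof.moves cs w hred hx (u ++ [s]) t (s :: t :: v) (by simp [hw0])
      have m3 := BProof.moves cs w hred hx (u ++ [s] ++ [t]) s (t :: v) (by simp [hw0])
      have m4 := BProof.moves cs w hred hx (u ++ [s] ++ [t] ++ [s]) t v (by simp [hw0])
      simp only [BProof.V_snoc] at m2 m3 m4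
      generalize BProof.V u = f at m1 m2 m3 m4
      obtain ⟨h1, h2⟩ | ⟨h1, h2⟩ : ((s : ℕ) = 0 ∧ (t : ℕ) = 1) ∨ ((s : ℕ) = 1 ∧ (t : ℕ) = 0) := by
        omega
      all_goals
        rw [h1] at m1 m2 m3 m4
        rw [h2] at m2 m3 m4
        simp [BProof.act] at m1 m2 m3 m4
        revert m1 m2 m3 m4
        cases f 0 <;> cases f 1 <;> simp
    · rw [h] at hpow
      rw [pow_succ, hpow, one_mul] at h4
      exact hne h4
    · rw [h] at hpow; exact hne2 hpow
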